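/- Consider the broadcast process on the infinite rooted d-regular tree with noisy labels τ, conditioned on the root label σ_ρ = 1, and assume λ²d > 1. Then E[Z'_{ρ,k}] = (Δ_{11} − 1/q)(λd)^k + d^k/q and E[Y^{(i)'}_{ρ,k}] = (Δ_{1i} − 1/q)(λd)^k + d^k/q for i ≠ 1. Moreover, with R = p(2 − p − p/(q−1)), there is a constant C such that Var(Z'_{ρ,k}) ≤ C d^k + (Σ_{j=1}^q Δ_{j1}²)·R d^k ((λ²d)^k − 1)/(λ²d − 1) and Var(Y^{(i)'}_{ρ,k}) ≤ C d^k + (Σ_{j=1}^q Δ_{ji}²)·R d^k ((λ²d)^k − 1)/(λ²d − 1). -/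

import Mathlib

open MeasureTheory ProbabilityTheory Filter

/-- Transition matrix of the broadcast process. -/
noncomputable def transM (q : ℕ) (p : ℝ) (a b : Fin q) : ℝ :=
  if a = b then 1 - p else p / ((q : ℝ) - 1)

/-- The number of vertices at depth `k` of the `d`-regular tree whose label is `i`. -/
def levelCount {Ω : Type} (q d : ℕ) (σ : List (Fin d) → Ω → Fin q) (i : Fin q) (k : ℕ)
    (ω : Ω) : ℕ :=
  (Finset.univ.filter (fun f : Fin k → Fin d => σ (List.ofFn f) ω = i)).card

/-! ### Moments of sums of independent coordinates -/

section ProductWeights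

variable {ι β : Type*} [Fintype ι] [DecidableEq ι] [Fintype β]

theorem sum_prod_weight (w : ι → β → ℝ) (hw : ∀ i, ∑ b, w i b = 1) :
    ∑ y : ι → β, ∏ i, w i (y i) = 1 := by
  have h := Finset.prod_univ_sum (fun _ : ι => (Finset.univ : Finset β)) w
  rw [Fintype.piFinset_univ] at h
  rw [← h]
  simp [hw]

theorem sum_prod_weight_mul_apply (w : ι → β → ℝ) (hw : ∀ i, ∑ b, w i b = 1)
    (φ : β → ℝ) (j : ι) :
    ∑ y : ι → β, (∏ i, w i (y i)) * φ (y j) = ∑ b, w j b * φ b := by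
  have h := Finset.prod_univ_sum (fun _ : ι => (Finset.univ : Finset β))
    (fun i b => w i b * if i = j then φ b else 1)
  rw [Fintype.piFinset_univ] at h
  have h1 : ∏ i, ∑ b, (w i b * if i = j then φ b else 1) = ∑ b, w j b * φ b := by
    rw [Fintype.prod_eq_single j]
    · simp
    · intro i hi
      simp [hi, hw]
  rw [← h1, h]
  refine Finset.sum_congr rfl fun y _ => ?_
  rw [Finset.prod_mul_distrib]
  simp

theorem sum_prod_weight_mul_apply_mul_apply (w : ι → β → ℝ) (hw : ∀ i, ∑ b, w i b = 1)
    (φ : β → ℝ) {j l : ι} (hjl : j ≠ l) :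
    ∑ y : ι → β, (∏ i, w i (y i)) * (φ (y j) * φ (y l)) =
      (∑ b, w j b * φ b) * ∑ b, w l b * φ b := by
  have h := Finset.prod_univ_sum (fun _ : ι => (Finset.univ : Finset β))
    (fun i b => w i b * ((if i = j then φ b else 1) * if i = l then φ b else 1))
  rw [Fintype.piFinset_univ] at h
  have h1 : ∏ i, ∑ b, (w i b * ((if i = j then φ b else 1) * if i = l then φ b else 1)) =
      (∑ b, w j b * φ b) * ∑ b, w l b * φ b := by
    rw [Fintype.prod_eq_mul j l hjl]
    · simp [hjl, hjl.symm]
    · rintro i ⟨hi, hi'⟩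
      simp [hi, hi', hw]
  rw [← h1, h]
  refine Finset.sum_congr rfl fun y _ => ?_
  rw [Finset.prod_mul_distrib, Finset.prod_mul_distrib]
  simp

theorem sum_prod_weight_mul_sum (w : ι → β → ℝ) (hw : ∀ i, ∑ b, w i b = 1) (φ : β → ℝ) :
    ∑ y : ι → β, (∏ i, w i (y i)) * ∑ i, φ (y i) = ∑ i, ∑ b, w i b * φ b := by
  simp_rw [Finset.mul_sum]
  rw [Finset.sum_comm]
  exact Finset.sum_congr rfl fun j _ => sum_prod_weight_mul_apply w hw φ j

theorem sum_prod_weight_mul_sum_sq (w : ι → β → ℝ) (hw : ∀ i, ∑ b, w i b = 1) (φ : β → ℝ) :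
    ∑ y : ι → β, (∏ i, w i (y i)) * (∑ i, φ (y i)) ^ 2 =
      (∑ i, ∑ b, w i b * φ b) ^ 2 +
        ∑ i, (∑ b, w i b * φ b ^ 2 - (∑ b, w i b * φ b) ^ 2) := by
  have hpair : ∀ j l : ι, ∑ y : ι → β, (∏ i, w i (y i)) * (φ (y j) * φ (y l)) =
      (∑ b, w j b * φ b) * (∑ b, w l b * φ b) +
        if j = l then ∑ b, w j b * φ b ^ 2 - (∑ b, w j b * φ b) ^ 2 else 0 := by
    intro j l
    split_ifs with hjl
    · subst hjl
      have := sum_prod_weight_mul_apply w hw (fun b => φ b ^ 2) j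
      simp only [← sq]
      rw [this]
      ring
    · rw [sum_prod_weight_mul_apply_mul_apply w hw φ hjl, add_zero]
  calc _ = ∑ y : ι → β, ∑ j, ∑ l, (∏ i, w i (y i)) * (φ (y j) * φ (y l)) := by
        refine Finset.sum_congr rfl fun y _ => ?_
        rw [sq, Finset.sum_mul_sum, Finset.mul_sum]
        simp_rw [Finset.mul_sum]
    _ = ∑ j, ∑ l, ∑ y : ι → β, (∏ i, w i (y i)) * (φ (y j) * φ (y l)) := by
        rw [Finset.sum_comm]
        exact Finset.sum_congr rfl fun j _ => Finset.sum_comm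
    _ = _ := by
        simp_rw [hpair, Finset.sum_add_distrib]
        rw [sq, Finset.sum_mul_sum]
        simp

/-- Variance of a nonnegative function against a probability vector. -/
theorem weight_variance_le (w : β → ℝ) (hw0 : ∀ b, 0 ≤ w b) (hw : ∑ b, w b = 1)
    (φ : β → ℝ) (hφ : ∀ b, 0 ≤ φ b) :
    ∑ b, w b * φ b ^ 2 - (∑ b, w b * φ b) ^ 2 ≤ (∑ b, φ b ^ 2) * (1 - ∑ b, w b ^ 2) := by
  have hw1 : ∀ b, w b ≤ 1 := fun b =>
    hw ▸ Finset.single_le_sum (fun c _ => hw0 c) (Finset.mem_univ b)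
  have hR : 1 - ∑ b, w b ^ 2 = ∑ b, w b * (1 - w b) := by
    simp_rw [mul_sub, mul_one, Finset.sum_sub_distrib, hw, sq]
  have h1 : ∑ b, (w b * φ b) ^ 2 ≤ (∑ b, w b * φ b) ^ 2 := by
    rw [sq (∑ b, w b * φ b), Finset.sum_mul]
    refine Finset.sum_le_sum fun b _ => ?_
    rw [sq]
    exact mul_le_mul_of_nonneg_left (Finset.single_le_sum
      (f := fun b => w b * φ b) (fun c _ => mul_nonneg (hw0 c) (hφ c)) (Finset.mem_univ b))
      (mul_nonneg (hw0 b) (hφ b))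
  have h2 : ∑ b, φ b ^ 2 * (w b * (1 - w b)) ≤ (∑ b, φ b ^ 2) * (1 - ∑ b, w b ^ 2) := by
    rw [hR, Finset.sum_mul]
    refine Finset.sum_le_sum fun b _ => mul_le_mul_of_nonneg_left ?_ (sq_nonneg _)
    exact Finset.single_le_sum (f := fun b => w b * (1 - w b))
      (fun c _ => mul_nonneg (hw0 c) (sub_nonneg.2 (hw1 c))) (Finset.mem_univ b)
  have h3 : ∑ b, w b * φ b ^ 2 - ∑ b, (w b * φ b) ^ 2 = ∑ b, φ b ^ 2 * (w b * (1 - w b)) := by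
    rw [← Finset.sum_sub_distrib]
    exact Finset.sum_congr rfl fun b _ => by ring
  linarith

end ProductWeights

/-! ### The transition matrix -/

theorem sum_transM_mul (q : ℕ) (p : ℝ) (φ : Fin q → ℝ) (a : Fin q) :
    ∑ b, transM q p a b * φ b =
      (1 - p - p / ((q : ℝ) - 1)) * φ a + p / ((q : ℝ) - 1) * ∑ b, φ b := by
  have h : ∀ b, transM q p a b * φ b =
      (if a = b then (1 - p - p / ((q : ℝ) - 1)) * φ b else 0) + p / ((q : ℝ) - 1) * φ b := by
    intro b
    unfold transM
    split_ifs <;> ring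
  simp_rw [h, Finset.sum_add_distrib, ← Finset.mul_sum]
  simp

theorem sum_transM (q : ℕ) (hq : 3 ≤ q) (p : ℝ) (a : Fin q) : ∑ b, transM q p a b = 1 := by
  have h := sum_transM_mul q p (fun _ => 1) a
  have hq' : (3 : ℝ) ≤ q := by exact_mod_cast hq
  have hne : (q : ℝ) - 1 ≠ 0 := by linarith
  simp only [mul_one, Finset.sum_const, Finset.card_univ, Fintype.card_fin, nsmul_eq_mul] at h
  rw [h]
  field_simp
  ring

theorem sum_transM_sq (q : ℕ) (hq : 3 ≤ q) (p : ℝ) (a : Fin q) :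
    1 - ∑ b, transM q p a b ^ 2 = p * (2 - p - p / ((q : ℝ) - 1)) := by
  have h := sum_transM_mul q p (transM q p a) a
  have hq' : (3 : ℝ) ≤ q := by exact_mod_cast hq
  have hne : (q : ℝ) - 1 ≠ 0 := by linarith
  simp_rw [sq]
  rw [h, sum_transM q hq]
  simp only [transM, if_true]
  field_simp
  ring

theorem transM_nonneg (q : ℕ) (hq : 3 ≤ q) (p : ℝ) (hp0 : 0 < p) (hp1 : p < 1) (a b : Fin q) :
    0 ≤ transM q p a b := by
  have hq' : (3 : ℝ) ≤ q := by exact_mod_cast hq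
  unfold transM
  split_ifs
  · linarith
  · exact div_nonneg hp0.le (by linarith)

/-- Summing over a level a function of the parent. -/
theorem sum_tail_eq {d k : ℕ} (h : (Fin k → Fin d) → ℝ) :
    ∑ f : Fin (k + 1) → Fin d, h (Fin.tail f) = d * ∑ f, h f := by
  rw [← (Fin.consEquiv fun _ => Fin d).sum_comp, Fintype.sum_prod_type]
  simp [Fin.consEquiv]

theorem prod_cons_eq {d k : ℕ} (h : (Fin (k + 1) → Fin d) → ℝ) :
    ∏ f : Fin k → Fin d, ∏ i, h (Fin.cons i f) = ∏ f, h f := by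
  rw [← (Fin.consEquiv fun _ => Fin d).prod_comp, Fintype.prod_prod_type, Finset.prod_comm]
  simp [Fin.consEquiv]

/-! ### The law of the labels at a fixed depth -/

/-- The law of the labels at depth `k` of the broadcast process started from root label `a`. -/
noncomputable def levelLaw (q d : ℕ) (p : ℝ) (a : Fin q) :
    (k : ℕ) → ((Fin k → Fin d) → Fin q) → ℝ
  | 0 => fun x => if x = fun _ => a then 1 else 0
  | k + 1 => fun y => ∑ x : (Fin k → Fin d) → Fin q,
      levelLaw q d p a k x * ∏ f, transM q p (x (Fin.tail f)) (y f)

theorem levelLaw_nonneg {q : ℕ} (d : ℕ) (hq : 3 ≤ q) {p : ℝ} (hp0 : 0 < p) (hp1 : p < 1)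
    (a : Fin q) (k : ℕ) (x : (Fin k → Fin d) → Fin q) : 0 ≤ levelLaw q d p a k x := by
  induction k with
  | zero =>
    unfold levelLaw
    split_ifs <;> norm_num
  | succ k ih =>
    exact Finset.sum_nonneg fun y _ => mul_nonneg (ih y)
      (Finset.prod_nonneg fun f _ => transM_nonneg q hq p hp0 hp1 _ _)

theorem sum_levelLaw_zero_mul (q d : ℕ) (p : ℝ) (a : Fin q)
    (F : ((Fin 0 → Fin d) → Fin q) → ℝ) :
    ∑ x, levelLaw q d p a 0 x * F x = F fun _ => a := by
  simp [levelLaw]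

theorem sum_levelLaw_succ_mul (q d : ℕ) (p : ℝ) (a : Fin q)
    (k : ℕ) (F : ((Fin (k + 1) → Fin d) → Fin q) → ℝ) :
    ∑ y, levelLaw q d p a (k + 1) y * F y =
      ∑ x, levelLaw q d p a k x * ∑ y, (∏ f, transM q p (x (Fin.tail f)) (y f)) * F y := by
  simp_rw [levelLaw, Finset.sum_mul, Finset.mul_sum]
  rw [Finset.sum_comm]
  simp_rw [mul_assoc]

theorem sum_levelLaw (q d : ℕ) (hq : 3 ≤ q) (p : ℝ) (a : Fin q)
    (k : ℕ) : ∑ x, levelLaw q d p a k x = 1 := by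
  induction k with
  | zero => simpa using sum_levelLaw_zero_mul q d p a fun _ => 1
  | succ k ih =>
    have h := sum_levelLaw_succ_mul q d p a k fun _ => 1
    simp only [mul_one] at h
    rw [h, ← ih]
    refine Finset.sum_congr rfl fun x _ => ?_
    rw [sum_prod_weight (fun f : Fin (k + 1) → Fin d => transM q p (x (Fin.tail f)))
      fun _ => sum_transM q hq p _, mul_one]

theorem levelLaw_mean_succ (q d : ℕ) (hq : 3 ≤ q) (p : ℝ) (a : Fin q)
    {g : Fin q → ℝ} {r c : ℝ}
    (hM : ∀ a, ∑ b, transM q p a b * g b = r * g a + c) (k : ℕ) :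
    ∑ x, levelLaw q d p a (k + 1) x * ∑ f, g (x f) =
      d * (r * ∑ x, levelLaw q d p a k x * ∑ f, g (x f)) + d * (c * d ^ k) := by
  have h : ∀ x : (Fin k → Fin d) → Fin q,
      ∑ y : (Fin (k + 1) → Fin d) → Fin q,
          (∏ f, transM q p (x (Fin.tail f)) (y f)) * ∑ f, g (y f) =
        d * (r * ∑ f, g (x f)) + d * (c * d ^ k) := by
    intro x
    rw [sum_prod_weight_mul_sum (fun f : Fin (k + 1) → Fin d => transM q p (x (Fin.tail f)))
      (fun _ => sum_transM q hq p _), sum_tail_eq fun f => ∑ b, transM q p (x f) b * g b]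
    simp_rw [hM, Finset.sum_add_distrib, ← Finset.mul_sum]
    simp
    ring
  rw [sum_levelLaw_succ_mul]
  simp_rw [h, mul_add, Finset.sum_add_distrib, ← Finset.sum_mul, sum_levelLaw q d hq p a,
    mul_left_comm (levelLaw q d p a k _), ← Finset.mul_sum, one_mul]

theorem levelLaw_mean (q d : ℕ) (hq : 3 ≤ q) (p : ℝ) (a : Fin q)
    {g : Fin q → ℝ} {r m : ℝ}
    (hM : ∀ a, ∑ b, transM q p a b * g b = r * g a + (1 - r) * m) (k : ℕ) :
    ∑ x, levelLaw q d p a k x * ∑ f, g (x f) = (g a - m) * (r * d) ^ k + d ^ k * m := by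
  induction k with
  | zero => rw [sum_levelLaw_zero_mul]; simp
  | succ k ih =>
    rw [levelLaw_mean_succ q d hq p a hM, ih]
    ring

theorem levelLaw_variance_le (q d : ℕ) (hq : 3 ≤ q) (p : ℝ) (a : Fin q)
    (hp0 : 0 < p) (hp1 : p < 1) {g : Fin q → ℝ} {r c G : ℝ}
    (hM : ∀ a, ∑ b, transM q p a b * g b = r * g a + c)
    (hG : ∀ a, ∑ b, transM q p a b * g b ^ 2 - (∑ b, transM q p a b * g b) ^ 2 ≤ G) (k : ℕ) :
    ∑ x, levelLaw q d p a k x * (∑ f, g (x f)) ^ 2 -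
        (∑ x, levelLaw q d p a k x * ∑ f, g (x f)) ^ 2 ≤
      G * d ^ k * ∑ j ∈ Finset.range k, (r ^ 2 * d) ^ j := by
  induction k with
  | zero => simp [sum_levelLaw_zero_mul]
  | succ k ih =>
    rw [levelLaw_mean_succ q d hq p a hM, sum_levelLaw_succ_mul]
    have h : ∀ x : (Fin k → Fin d) → Fin q,
        ∑ y : (Fin (k + 1) → Fin d) → Fin q,
            (∏ f, transM q p (x (Fin.tail f)) (y f)) * (∑ f, g (y f)) ^ 2 ≤
          (d * (r * ∑ f, g (x f)) + d * (c * d ^ k)) ^ 2 + d ^ (k + 1) * G := by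
      intro x
      rw [sum_prod_weight_mul_sum_sq (fun f : Fin (k + 1) → Fin d => transM q p (x (Fin.tail f)))
        (fun _ => sum_transM q hq p _)]
      refine add_le_add (le_of_eq ?_) ?_
      · rw [sum_tail_eq fun f => ∑ b, transM q p (x f) b * g b]
        simp_rw [hM, Finset.sum_add_distrib, ← Finset.mul_sum]
        simp
        ring
      · refine (Finset.sum_le_sum fun f _ => hG (x (Fin.tail f))).trans (le_of_eq ?_)
        simp
    have h' := Finset.sum_le_sum fun x (_ : x ∈ Finset.univ) =>
      mul_le_mul_of_nonneg_left (h x) (levelLaw_nonneg d hq hp0 hp1 a k x)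
    refine (sub_le_sub_right h' _).trans ?_
    have hexp : ∑ x, levelLaw q d p a k x *
          ((d * (r * ∑ f, g (x f)) + d * (c * d ^ k)) ^ 2 + d ^ (k + 1) * G) =
        d ^ 2 * r ^ 2 * ∑ x, levelLaw q d p a k x * (∑ f, g (x f)) ^ 2 +
          2 * d ^ 2 * r * c * d ^ k * ∑ x, levelLaw q d p a k x * ∑ f, g (x f) +
          (d ^ 2 * c ^ 2 * (d ^ k) ^ 2 + d ^ (k + 1) * G) * ∑ x, levelLaw q d p a k x := by
      rw [Finset.mul_sum, Finset.mul_sum, Finset.mul_sum, ← Finset.sum_add_distrib,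
        ← Finset.sum_add_distrib]
      exact Finset.sum_congr rfl fun x _ => by ring
    rw [hexp, sum_levelLaw q d hq p a, Finset.sum_range_succ', Finset.sum_congr rfl
      fun j _ => pow_succ (r ^ 2 * (d : ℝ)) j, ← Finset.sum_mul]
    have := mul_le_mul_of_nonneg_left ih (by positivity : (0 : ℝ) ≤ d ^ 2 * r ^ 2)
    rw [← sub_nonneg] at this ⊢
    refine this.trans (le_of_eq ?_)
    ring

/-! ### Marginals of the broadcast process -/

/-- The joint law of labels and noisy labels up to every finite depth. -/
def HasBroadcastLaw {Ω : Type} [MeasurableSpace Ω] (μ : Measure Ω) (q d : ℕ) (p : ℝ)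
    (Δ : Fin q → Fin q → ℝ) (σ τ : List (Fin d) → Ω → Fin q) : Prop :=
  ∀ (k : ℕ) (ℓ t : List (Fin d) → Fin q),
    (μ {ω | ∀ v : List (Fin d), v.length ≤ k → σ v ω = ℓ v ∧ τ v ω = t v}).toReal
      = ((q : ℝ))⁻¹ *
        (∏ j ∈ Finset.range k, ∏ f : Fin j → Fin d, ∏ i : Fin d,
          transM q p (ℓ (List.ofFn f)) (ℓ (i :: List.ofFn f))) *
        ∏ j ∈ Finset.range (k + 1), ∏ f : Fin j → Fin d,
          Δ (ℓ (List.ofFn f)) (t (List.ofFn f))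

/-- The labels at depth `k`. -/
def levelLabels {Ω : Type} {q d : ℕ} (σ : List (Fin d) → Ω → Fin q) (k : ℕ) (ω : Ω) :
    (Fin k → Fin d) → Fin q :=
  fun f => σ (List.ofFn f) ω

theorem measurable_levelLabels {Ω : Type} [MeasurableSpace Ω] {q d : ℕ}
    {σ : List (Fin d) → Ω → Fin q} (hσ : ∀ v, Measurable (σ v)) (k : ℕ) :
    Measurable (levelLabels σ k) :=
  measurable_pi_lambda _ fun _ => hσ _

/-- Overwrite a labelling of the tree at depth `k` by `y`. -/
def overwriteLevel {q d : ℕ} (k : ℕ) (ℓ : List (Fin d) → Fin q) (y : (Fin k → Fin d) → Fin q)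
    (v : List (Fin d)) : Fin q :=
  if h : v.length = k then y fun j => v.get (Fin.cast h.symm j) else ℓ v

theorem overwriteLevel_of_ne {q d k : ℕ} (ℓ : List (Fin d) → Fin q)
    (y : (Fin k → Fin d) → Fin q) {v : List (Fin d)} (hv : v.length ≠ k) :
    overwriteLevel k ℓ y v = ℓ v :=
  dif_neg hv

theorem overwriteLevel_ofFn {q d k : ℕ} (ℓ : List (Fin d) → Fin q)
    (y : (Fin k → Fin d) → Fin q) (f : Fin k → Fin d) :
    overwriteLevel k ℓ y (List.ofFn f) = y f := by
  simp [overwriteLevel]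

theorem levelCount_eq_sum {Ω : Type} {q d : ℕ} (τ : List (Fin d) → Ω → Fin q) (i : Fin q)
    (k : ℕ) (ω : Ω) :
    (levelCount q d τ i k ω : ℝ) = ∑ f, if levelLabels τ k ω f = i then (1 : ℝ) else 0 := by
  rw [levelCount, Finset.card_filter]
  push_cast
  rfl

theorem exists_ofFn_eq {d k : ℕ} {v : List (Fin d)} (hv : v.length = k) :
    ∃ f : Fin k → Fin d, v = List.ofFn f := by
  subst hv
  exact ⟨v.get, (List.ofFn_get v).symm⟩

theorem measureReal_eq_sum_inter_preimage {Ω κ : Type*} [MeasurableSpace Ω] (μ : Measure Ω)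
    [IsProbabilityMeasure μ] [Fintype κ] {H : Ω → κ} (hH : ∀ h, MeasurableSet (H ⁻¹' {h}))
    (A : Set Ω) : μ.real A = ∑ h, μ.real (A ∩ H ⁻¹' {h}) := by
  have h := sum_measureReal_preimage_singleton (μ := μ.restrict A) Finset.univ
    fun h _ => hH h
  simp only [measureReal_restrict_apply (hH _), Finset.coe_univ, Set.preimage_univ,
    measureReal_restrict_apply MeasurableSet.univ, Set.univ_inter] at h
  rw [← h]
  exact Finset.sum_congr rfl fun x _ => by rw [Set.inter_comm]

namespace HasBroadcastLaw

variable {Ω : Type} [MeasurableSpace Ω] {μ : Measure Ω} {q d : ℕ} {p : ℝ}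
  {Δ : Fin q → Fin q → ℝ} {σ τ : List (Fin d) → Ω → Fin q}

theorem measureReal_extend (hlaw : HasBroadcastLaw μ q d p Δ σ τ) (k : ℕ)
    (ℓ t : List (Fin d) → Fin q) (y s : (Fin (k + 1) → Fin d) → Fin q) :
    μ.real ({ω | ∀ v : List (Fin d), v.length ≤ k → σ v ω = ℓ v ∧ τ v ω = t v} ∩
        {ω | levelLabels σ (k + 1) ω = y ∧ levelLabels τ (k + 1) ω = s}) =
      μ.real {ω | ∀ v : List (Fin d), v.length ≤ k → σ v ω = ℓ v ∧ τ v ω = t v} *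
        ((∏ f, transM q p (ℓ (List.ofFn (Fin.tail f))) (y f)) * ∏ f, Δ (y f) (s f)) := by
  have hset : {ω | ∀ v : List (Fin d), v.length ≤ k → σ v ω = ℓ v ∧ τ v ω = t v} ∩
        {ω | levelLabels σ (k + 1) ω = y ∧ levelLabels τ (k + 1) ω = s} =
      {ω | ∀ v : List (Fin d), v.length ≤ k + 1 →
        σ v ω = overwriteLevel (k + 1) ℓ y v ∧ τ v ω = overwriteLevel (k + 1) t s v} := by
    ext ω
    simp only [Set.mem_inter_iff, Set.mem_ofPred_eq]
    constructor
    · rintro ⟨h1, h2, h3⟩ v hv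
      rcases hv.lt_or_eq with hv | hv
      · rw [overwriteLevel_of_ne _ _ hv.ne, overwriteLevel_of_ne _ _ hv.ne]
        exact h1 v (Nat.lt_succ_iff.1 hv)
      · obtain ⟨f, rfl⟩ := exists_ofFn_eq hv
        rw [overwriteLevel_ofFn, overwriteLevel_ofFn, ← h2, ← h3]
        exact ⟨rfl, rfl⟩
    · intro h
      refine ⟨fun v hv => ?_, funext fun f => ?_, funext fun f => ?_⟩
      · have := h v (by omega)
        rwa [overwriteLevel_of_ne _ _ (by omega), overwriteLevel_of_ne _ _ (by omega)] at this
      · have := (h (List.ofFn f) (by simp)).1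
        rwa [overwriteLevel_ofFn] at this
      · have := (h (List.ofFn f) (by simp)).2
        rwa [overwriteLevel_ofFn] at this
  have hlt : ∀ {j : ℕ} (f : Fin j → Fin d) (ℓ : List (Fin d) → Fin q)
      (y : (Fin (k + 1) → Fin d) → Fin q), j ≤ k →
      overwriteLevel (k + 1) ℓ y (List.ofFn f) = ℓ (List.ofFn f) := by
    intro j f ℓ y hj
    exact overwriteLevel_of_ne _ _ (by simp; omega)
  have h1 : ∏ j ∈ Finset.range k, ∏ f : Fin j → Fin d, ∏ i : Fin d,
        transM q p (overwriteLevel (k + 1) ℓ y (List.ofFn f))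
          (overwriteLevel (k + 1) ℓ y (i :: List.ofFn f)) =
      ∏ j ∈ Finset.range k, ∏ f : Fin j → Fin d, ∏ i : Fin d,
        transM q p (ℓ (List.ofFn f)) (ℓ (i :: List.ofFn f)) := by
    refine Finset.prod_congr rfl fun j hj => Finset.prod_congr rfl fun f _ =>
      Finset.prod_congr rfl fun i _ => ?_
    have hj' := Finset.mem_range.1 hj
    rw [hlt f ℓ y hj'.le, overwriteLevel_of_ne _ _ (by simp; omega)]
  have h2 : ∏ j ∈ Finset.range (k + 1), ∏ f : Fin j → Fin d,
        Δ (overwriteLevel (k + 1) ℓ y (List.ofFn f)) (overwriteLevel (k + 1) t s (List.ofFn f)) =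
      ∏ j ∈ Finset.range (k + 1), ∏ f : Fin j → Fin d,
        Δ (ℓ (List.ofFn f)) (t (List.ofFn f)) := by
    refine Finset.prod_congr rfl fun j hj => Finset.prod_congr rfl fun f _ => ?_
    have hj' := Nat.lt_succ_iff.1 (Finset.mem_range.1 hj)
    rw [hlt f ℓ y hj', hlt f t s hj']
  have h3 : ∏ f : Fin k → Fin d, ∏ i : Fin d,
        transM q p (overwriteLevel (k + 1) ℓ y (List.ofFn f))
          (overwriteLevel (k + 1) ℓ y (i :: List.ofFn f)) =
      ∏ f, transM q p (ℓ (List.ofFn (Fin.tail f))) (y f) := by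
    rw [← prod_cons_eq]
    refine Finset.prod_congr rfl fun f _ => Finset.prod_congr rfl fun i _ => ?_
    rw [hlt f ℓ y le_rfl, Fin.tail_cons, ← List.ofFn_cons, overwriteLevel_ofFn]
  have e1 := hlaw (k + 1) (overwriteLevel (k + 1) ℓ y) (overwriteLevel (k + 1) t s)
  have e2 := hlaw k ℓ t
  rw [Finset.prod_range_succ, Finset.prod_range_succ _ (k + 1), h1, h2, h3] at e1
  simp only [overwriteLevel_ofFn] at e1
  rw [hset, measureReal_def, measureReal_def, e1, e2]
  ring

/-- The labels and noisy labels at depth at most `k`. -/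
def history (σ τ : List (Fin d) → Ω → Fin q) (k : ℕ) (ω : Ω) :
    {v : List (Fin d) // v.length ≤ k} → Fin q × Fin q :=
  fun v => (σ v ω, τ v ω)

instance (k : ℕ) : Finite {v : List (Fin d) // v.length ≤ k} :=
  (List.finite_length_le (Fin d) k).to_subtype

theorem measurableSet_history_fiber (hσ : ∀ v, Measurable (σ v)) (hτ : ∀ v, Measurable (τ v))
    (k : ℕ) (h : {v : List (Fin d) // v.length ≤ k} → Fin q × Fin q) :
    MeasurableSet (history σ τ k ⁻¹' {h}) := by
  have : Measurable (history σ τ k) :=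
    measurable_pi_lambda _ fun v => (hσ v).prodMk (hτ v)
  exact this (measurableSet_singleton h)

theorem measureReal_step [IsProbabilityMeasure μ] (hlaw : HasBroadcastLaw μ q d p Δ σ τ)
    (hσ : ∀ v, Measurable (σ v)) (hτ : ∀ v, Measurable (τ v)) (k : ℕ) (a : Fin q)
    (x : (Fin k → Fin d) → Fin q) (y s : (Fin (k + 1) → Fin d) → Fin q) :
    μ.real ({ω | σ [] ω = a ∧ levelLabels σ k ω = x} ∩
        {ω | levelLabels σ (k + 1) ω = y ∧ levelLabels τ (k + 1) ω = s}) =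
      μ.real {ω | σ [] ω = a ∧ levelLabels σ k ω = x} *
        ((∏ f, transM q p (x (Fin.tail f)) (y f)) * ∏ f, Δ (y f) (s f)) := by
  classical
  have := Fintype.ofFinite ({v : List (Fin d) // v.length ≤ k} → Fin q × Fin q)
  rw [measureReal_eq_sum_inter_preimage μ (measurableSet_history_fiber hσ hτ k),
    measureReal_eq_sum_inter_preimage μ (measurableSet_history_fiber hσ hτ k)
      {ω | σ [] ω = a ∧ levelLabels σ k ω = x}, Finset.sum_mul]
  refine Finset.sum_congr rfl fun h _ => ?_
  rw [Set.inter_right_comm]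
  rcases ({ω | σ [] ω = a ∧ levelLabels σ k ω = x} ∩
    history σ τ k ⁻¹' {h}).eq_empty_or_nonempty with he | ⟨ω₀, ⟨rfl, rfl⟩, rfl⟩
  · simp [he]
  · have hset : {ω | σ [] ω = σ [] ω₀ ∧ levelLabels σ k ω = levelLabels σ k ω₀} ∩
          history σ τ k ⁻¹' {history σ τ k ω₀} =
        {ω | ∀ v : List (Fin d), v.length ≤ k → σ v ω = σ v ω₀ ∧ τ v ω = τ v ω₀} := by
      ext ω
      simp only [Set.mem_inter_iff, Set.mem_ofPred_eq, Set.mem_preimage, Set.mem_singleton_iff]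
      constructor
      · rintro ⟨-, h⟩ v hv
        exact Prod.ext_iff.1 (congrFun h ⟨v, hv⟩)
      · intro h
        refine ⟨⟨(h [] (by simp)).1, funext fun f => (h _ (by simp)).1⟩,
          funext fun v => Prod.ext_iff.2 (h v v.2)⟩
    rw [hset]
    exact hlaw.measureReal_extend k (fun v => σ v ω₀) (fun v => τ v ω₀) y s

theorem measureReal_root (hlaw : HasBroadcastLaw μ q d p Δ σ τ) (a b : Fin q) :
    μ.real {ω | σ [] ω = a ∧ τ [] ω = b} = (q : ℝ)⁻¹ * Δ a b := by
  have h := hlaw 0 (fun _ => a) fun _ => b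
  simpa [measureReal_def] using h

theorem measureReal_root_eq [IsProbabilityMeasure μ] (hlaw : HasBroadcastLaw μ q d p Δ σ τ)
    (hτ : ∀ v, Measurable (τ v)) (a : Fin q) :
    μ.real {ω | σ [] ω = a} = (q : ℝ)⁻¹ * ∑ b, Δ a b := by
  rw [measureReal_eq_sum_inter_preimage μ fun b => hτ [] (measurableSet_singleton b),
    Finset.mul_sum]
  exact Finset.sum_congr rfl fun b _ => hlaw.measureReal_root a b

/-- Consistency of the laws at depths `0` and `1` forces the noise matrix to be row-stochastic
as soon as the transition matrix is invertible. -/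
theorem sum_noise_eq_one [IsProbabilityMeasure μ] (hlaw : HasBroadcastLaw μ q d p Δ σ τ)
    (hσ : ∀ v, Measurable (σ v)) (hτ : ∀ v, Measurable (τ v)) (hq : 3 ≤ q) (hd : 1 ≤ d)
    (hp0 : 0 < p) (hp1 : p < 1) (hne : 1 - p - p / ((q : ℝ) - 1) ≠ 0)
    (hΔ0 : ∀ i j, 0 ≤ Δ i j) (hΔcol : ∀ j, ∑ i, Δ i j = 1) (hΔdiag : ∀ i, 0 < Δ i i)
    (a : Fin q) : ∑ b, Δ a b = 1 := by
  have hq' : (3 : ℝ) ≤ q := by exact_mod_cast hq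
  have hq1 : (q : ℝ) - 1 ≠ 0 := by linarith
  have hset : {ω | σ [] ω = a ∧ levelLabels σ 0 ω = fun _ => a} = {ω | σ [] ω = a} := by
    ext ω
    simp only [Set.mem_ofPred_eq, and_iff_left_iff_imp]
    intro h
    funext f
    simp [levelLabels, h]
  have hpos : 0 < μ.real {ω | σ [] ω = a} := by
    rw [hlaw.measureReal_root_eq hτ]
    refine mul_pos (by positivity) ((hΔdiag a).trans_le ?_)
    exact Finset.single_le_sum (f := fun b => Δ a b) (fun b _ => hΔ0 a b) (Finset.mem_univ a)
  have hfib : ∀ z : ((Fin 1 → Fin d) → Fin q) × ((Fin 1 → Fin d) → Fin q), MeasurableSet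
      ((fun ω => (levelLabels σ 1 ω, levelLabels τ 1 ω)) ⁻¹' {z}) := fun z =>
    ((measurable_levelLabels hσ 1).prodMk (measurable_levelLabels hτ 1))
      (measurableSet_singleton z)
  have hstep := measureReal_eq_sum_inter_preimage μ hfib {ω | σ [] ω = a}
  have hterm : ∀ z : ((Fin 1 → Fin d) → Fin q) × ((Fin 1 → Fin d) → Fin q),
      μ.real ({ω | σ [] ω = a} ∩
        (fun ω => (levelLabels σ 1 ω, levelLabels τ 1 ω)) ⁻¹' {z}) =
      μ.real {ω | σ [] ω = a} * ∏ f, (transM q p a (z.1 f) * Δ (z.1 f) (z.2 f)) := by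
    rintro ⟨y, s⟩
    have h := hlaw.measureReal_step hσ hτ 0 a (fun _ => a) y s
    rw [hset] at h
    rw [Finset.prod_mul_distrib, ← h]
    congr 2
    ext ω
    simp
  simp_rw [hterm, ← Finset.mul_sum, Fintype.sum_prod_type] at hstep
  have hprod : ∑ y : (Fin 1 → Fin d) → Fin q, ∑ s : (Fin 1 → Fin d) → Fin q,
      ∏ f, (transM q p a (y f) * Δ (y f) (s f)) =
      (∑ b, transM q p a b * ∑ c, Δ b c) ^ d := by
    have h1 : ∀ y : (Fin 1 → Fin d) → Fin q, ∑ s : (Fin 1 → Fin d) → Fin q,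
        ∏ f, (transM q p a (y f) * Δ (y f) (s f)) =
        ∏ f, (transM q p a (y f) * ∑ c, Δ (y f) c) := by
      intro y
      simp_rw [Finset.mul_sum]
      rw [Finset.prod_univ_sum, Fintype.piFinset_univ]
    simp_rw [h1]
    have h2 := Finset.prod_univ_sum (fun _ : Fin 1 → Fin d => (Finset.univ : Finset (Fin q)))
      fun _ b => transM q p a b * ∑ c, Δ b c
    rw [Fintype.piFinset_univ] at h2
    rw [← h2]
    simp
  rw [hprod, eq_comm, mul_eq_left₀ hpos.ne'] at hstep
  have h0 : 0 ≤ ∑ b, transM q p a b * ∑ c, Δ b c := Finset.sum_nonneg fun b _ =>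
    mul_nonneg (transM_nonneg q hq p hp0 hp1 a b) (Finset.sum_nonneg fun c _ => hΔ0 b c)
  rw [pow_eq_one_iff_of_nonneg h0 (by omega), sum_transM_mul q p fun b => ∑ c, Δ b c,
    Finset.sum_comm] at hstep
  simp only [hΔcol, Finset.sum_const, Finset.card_univ, Fintype.card_fin, nsmul_eq_mul,
    mul_one] at hstep
  have hrow : (1 - p - p / ((q : ℝ) - 1)) + p / ((q : ℝ) - 1) * q = 1 := by
    field_simp
    ring
  refine mul_left_cancel₀ hne ?_
  linarith

theorem measureReal_root_inter_levelLabels [IsProbabilityMeasure μ]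
    (hlaw : HasBroadcastLaw μ q d p Δ σ τ) (hσ : ∀ v, Measurable (σ v))
    (hτ : ∀ v, Measurable (τ v)) (hrow : ∀ a, ∑ b, Δ a b = 1)
    (a : Fin q) (k : ℕ)
    (y s : (Fin k → Fin d) → Fin q) :
    μ.real ({ω | σ [] ω = a} ∩ {ω | levelLabels σ k ω = y ∧ levelLabels τ k ω = s}) =
      (q : ℝ)⁻¹ * (levelLaw q d p a k y * ∏ f, Δ (y f) (s f)) := by
  induction k with
  | zero =>
    have hs : s = fun _ => s default := funext fun f => by rw [Subsingleton.elim f default]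
    by_cases hya : y = fun _ => a
    · have hset : {ω | σ [] ω = a} ∩ {ω | levelLabels σ 0 ω = y ∧ levelLabels τ 0 ω = s} =
          {ω | σ [] ω = a ∧ τ [] ω = s default} := by
        ext ω
        rw [hya, hs]
        simp [levelLabels, funext_iff]
      rw [hset, hlaw.measureReal_root]
      simp [levelLaw, hya]
    · have hset : {ω | σ [] ω = a} ∩ {ω | levelLabels σ 0 ω = y ∧ levelLabels τ 0 ω = s} =
          ∅ := by
        ext ω
        simp only [Set.mem_inter_iff, Set.mem_ofPred_eq, Set.mem_empty_iff_false, iff_false]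
        rintro ⟨h, rfl, -⟩
        exact hya (funext fun f => by simp [levelLabels, h])
      simp [hset, levelLaw, hya]
  | succ k ih =>
    have hmarg : ∀ x : (Fin k → Fin d) → Fin q,
        μ.real {ω | σ [] ω = a ∧ levelLabels σ k ω = x} =
          (q : ℝ)⁻¹ * levelLaw q d p a k x := by
      intro x
      rw [measureReal_eq_sum_inter_preimage μ fun s =>
        measurable_levelLabels hτ k (measurableSet_singleton s)]
      have h : ∀ s, μ.real ({ω | σ [] ω = a ∧ levelLabels σ k ω = x} ∩
          levelLabels τ k ⁻¹' {s}) =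
          (q : ℝ)⁻¹ * levelLaw q d p a k x * ∏ f, Δ (x f) (s f) := by
        intro s
        rw [mul_assoc, ← ih x s]
        congr 1
        ext ω
        simp [and_assoc]
      simp_rw [h]
      rw [← Finset.mul_sum, sum_prod_weight (fun f => Δ (x f)) fun f => hrow _, mul_one]
    rw [measureReal_eq_sum_inter_preimage μ fun x =>
      measurable_levelLabels hσ k (measurableSet_singleton x), levelLaw, Finset.sum_mul,
      Finset.mul_sum]
    refine Finset.sum_congr rfl fun x _ => ?_
    rw [mul_assoc, ← mul_assoc, ← hmarg, ← hlaw.measureReal_step hσ hτ]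
    congr 1
    ext ω
    simp only [Set.mem_inter_iff, Set.mem_ofPred_eq, Set.mem_preimage, Set.mem_singleton_iff]
    tauto

theorem isProbabilityMeasure_cond_root [IsProbabilityMeasure μ]
    (hlaw : HasBroadcastLaw μ q d p Δ σ τ)
    (hτ : ∀ v, Measurable (τ v)) (hrow : ∀ a, ∑ b, Δ a b = 1)
    (a : Fin q) :
    IsProbabilityMeasure (μ[|{ω | σ [] ω = a}]) := by
  refine cond_isProbabilityMeasure fun h => ?_
  have h1 := hlaw.measureReal_root_eq hτ a
  rw [hrow, mul_one, measureReal_def, h] at h1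
  have hq0 : (0 : ℝ) < q := by exact_mod_cast a.pos
  have := inv_pos.2 hq0
  simp only [ENNReal.toReal_zero] at h1
  linarith

theorem integral_levelLabels [IsProbabilityMeasure μ]
    (hlaw : HasBroadcastLaw μ q d p Δ σ τ) (hσ : ∀ v, Measurable (σ v))
    (hτ : ∀ v, Measurable (τ v)) (hrow : ∀ a, ∑ b, Δ a b = 1)
    (a : Fin q) (k : ℕ) (F : ((Fin k → Fin d) → Fin q) → ℝ) :
    ∫ ω, F (levelLabels τ k ω) ∂(μ[|{ω | σ [] ω = a}]) =
      ∑ x, levelLaw q d p a k x * ∑ s, (∏ f, Δ (x f) (s f)) * F s := by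
  have hm := measurable_levelLabels hτ k
  have hq0 : (q : ℝ) ≠ 0 := by exact_mod_cast a.pos.ne'
  have hroot : MeasurableSet {ω | σ [] ω = a} := hσ [] (measurableSet_singleton a)
  have := hlaw.isProbabilityMeasure_cond_root hτ hrow a
  have hF : Measurable F := measurable_of_finite F
  rw [← integral_map (f := F) hm.aemeasurable hF.aestronglyMeasurable]
  have := Measure.isProbabilityMeasure_map (μ := μ[|{ω | σ [] ω = a}]) hm.aemeasurable
  rw [integral_fintype Integrable.of_finite]
  have hs : ∀ s, ((μ[|{ω | σ [] ω = a}]).map (levelLabels τ k)).real {s} =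
      ∑ x, levelLaw q d p a k x * ∏ f, Δ (x f) (s f) := by
    intro s
    rw [map_measureReal_apply hm (measurableSet_singleton s), measureReal_def,
      cond_apply hroot, ENNReal.toReal_mul, ENNReal.toReal_inv, ← measureReal_def,
      ← measureReal_def, hlaw.measureReal_root_eq hτ, hrow, mul_one, inv_inv,
      measureReal_eq_sum_inter_preimage μ fun x =>
        measurable_levelLabels hσ k (measurableSet_singleton x), Finset.mul_sum]
    refine Finset.sum_congr rfl fun x _ => ?_
    have h := hlaw.measureReal_root_inter_levelLabels hσ hτ hrow a k x s
    rw [← mul_right_inj' hq0, mul_inv_cancel_left₀ hq0] at h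
    rw [← h, Set.inter_assoc]
    congr 3
    ext ω
    simp [and_comm]
  simp_rw [hs, smul_eq_mul, Finset.sum_mul, Finset.mul_sum]
  rw [Finset.sum_comm]
  simp_rw [mul_assoc]

theorem integral_levelCount [IsProbabilityMeasure μ]
    (hlaw : HasBroadcastLaw μ q d p Δ σ τ) (hσ : ∀ v, Measurable (σ v))
    (hτ : ∀ v, Measurable (τ v)) (hrow : ∀ a, ∑ b, Δ a b = 1)
    (hq : 3 ≤ q) (hΔcol : ∀ j, ∑ i, Δ i j = 1) (a i : Fin q) (k : ℕ) :
    ∫ ω, (levelCount q d τ i k ω : ℝ) ∂(μ[|{ω | σ [] ω = a}]) =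
      (Δ a i - 1 / (q : ℝ)) * ((1 - p - p / ((q : ℝ) - 1)) * d) ^ k + (d : ℝ) ^ k / q := by
  have hq' : (3 : ℝ) ≤ q := by exact_mod_cast hq
  have hq1 : (q : ℝ) - 1 ≠ 0 := by linarith
  simp_rw [levelCount_eq_sum]
  rw [hlaw.integral_levelLabels hσ hτ hrow a k fun s => ∑ f, if s f = i then (1 : ℝ) else 0]
  have h : ∀ x : (Fin k → Fin d) → Fin q, ∑ s : (Fin k → Fin d) → Fin q,
      (∏ f, Δ (x f) (s f)) * ∑ f, (if s f = i then (1 : ℝ) else 0) = ∑ f, Δ (x f) i := by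
    intro x
    rw [sum_prod_weight_mul_sum (fun f => Δ (x f)) (fun f => hrow _)
      fun b => if b = i then (1 : ℝ) else 0]
    simp
  simp_rw [h]
  rw [levelLaw_mean q d hq p a (g := fun b => Δ b i) (r := 1 - p - p / ((q : ℝ) - 1))
    (m := 1 / q)]
  · ring
  · intro b
    rw [sum_transM_mul, hΔcol]
    field_simp
    ring

theorem variance_levelCount_le [IsProbabilityMeasure μ]
    (hlaw : HasBroadcastLaw μ q d p Δ σ τ) (hσ : ∀ v, Measurable (σ v))
    (hτ : ∀ v, Measurable (τ v)) (hrow : ∀ a, ∑ b, Δ a b = 1)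
    (hq : 3 ≤ q) (hp0 : 0 < p) (hp1 : p < 1)
    (hΔ0 : ∀ i j, 0 ≤ Δ i j) (a i : Fin q) (k : ℕ) :
    variance (fun ω => (levelCount q d τ i k ω : ℝ)) (μ[|{ω | σ [] ω = a}]) ≤
      d ^ k + (∑ j, Δ j i ^ 2) * (p * (2 - p - p / ((q : ℝ) - 1))) * d ^ k *
        ∑ j ∈ Finset.range k, ((1 - p - p / ((q : ℝ) - 1)) ^ 2 * d) ^ j := by
  have := hlaw.isProbabilityMeasure_cond_root hτ hrow a
  have hm := measurable_levelLabels hτ k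
  have hL2 : MemLp (fun ω => ∑ f, if levelLabels τ k ω f = i then (1 : ℝ) else 0) 2
      (μ[|{ω | σ [] ω = a}]) := by
    refine memLp_finsetSum _ fun f _ => ?_
    refine MemLp.of_bound (C := 1) ?_ (ae_of_all _ fun ω => ?_)
    · exact ((measurable_of_finite fun s : (Fin k → Fin d) → Fin q =>
        if s f = i then (1 : ℝ) else 0).comp hm).aestronglyMeasurable
    · split_ifs <;> simp
  simp_rw [levelCount_eq_sum]
  rw [variance_eq_sub hL2]
  have e1 := hlaw.integral_levelLabels hσ hτ hrow a k
    fun s => ∑ f, if s f = i then (1 : ℝ) else 0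
  have e2 := hlaw.integral_levelLabels hσ hτ hrow a k
    fun s => (∑ f, if s f = i then (1 : ℝ) else 0) ^ 2
  have h1 : ∀ x : (Fin k → Fin d) → Fin q, ∑ s : (Fin k → Fin d) → Fin q,
      (∏ f, Δ (x f) (s f)) * ∑ f, (if s f = i then (1 : ℝ) else 0) = ∑ f, Δ (x f) i := by
    intro x
    rw [sum_prod_weight_mul_sum (fun f => Δ (x f)) (fun f => hrow _)
      fun b => if b = i then (1 : ℝ) else 0]
    simp
  have h2 : ∀ x : (Fin k → Fin d) → Fin q, ∑ s : (Fin k → Fin d) → Fin q,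
      (∏ f, Δ (x f) (s f)) * (∑ f, if s f = i then (1 : ℝ) else 0) ^ 2 ≤
        (∑ f, Δ (x f) i) ^ 2 + d ^ k := by
    intro x
    rw [sum_prod_weight_mul_sum_sq (fun f => Δ (x f)) (fun f => hrow _)
      fun b => if b = i then (1 : ℝ) else 0]
    simp only [ite_pow, one_pow, mul_ite, mul_one, mul_zero, ne_eq, OfNat.ofNat_ne_zero,
      not_false_eq_true, zero_pow, Finset.sum_ite_eq', Finset.mem_univ, if_true]
    gcongr
    calc ∑ f, (Δ (x f) i - Δ (x f) i ^ 2) ≤ ∑ f : Fin k → Fin d, (1 : ℝ) :=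
          Finset.sum_le_sum fun f _ => by nlinarith [sq_nonneg (Δ (x f) i - 1)]
      _ = d ^ k := by simp
  simp_rw [h1] at e1
  have h3 := levelLaw_variance_le q d hq p a hp0 hp1 (g := fun b => Δ b i)
    (fun b => sum_transM_mul q p (fun c => Δ c i) b)
    (fun b => (weight_variance_le (transM q p b) (fun c => transM_nonneg q hq p hp0 hp1 b c)
      (sum_transM q hq p b) (fun c => Δ c i) fun c => hΔ0 c i).trans_eq
        (by rw [sum_transM_sq q hq p b])) k
  have h4 := Finset.sum_le_sum fun x (_ : x ∈ Finset.univ) =>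
    mul_le_mul_of_nonneg_left (h2 x) (levelLaw_nonneg d hq hp0 hp1 a k x)
  simp_rw [mul_add, Finset.sum_add_distrib, ← Finset.sum_mul, sum_levelLaw q d hq p a,
    one_mul] at h4
  simp only [Pi.pow_apply]
  rw [e1, e2]
  linarith

end HasBroadcastLaw

/-- Broadcast process on the rooted `d`-regular tree with noisy labels `τ`
(each `τ_u = j` with probability `Δ_{σ_u j}`, independently), conditioned on root label `1`,
assuming `λ²d > 1`.  Then `E[Z'_{ρ,k}] = (Δ_{11} − 1/q)(λd)^k + d^k/q`,
`E[Y^{(i)'}_{ρ,k}] = (Δ_{1i} − 1/q)(λd)^k + d^k/q` for `i ≠ 1`, and with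
`R = p(2 − p − p/(q−1))` there is a constant `C` with
`Var(Z'_{ρ,k}) ≤ C d^k + (Σ_j Δ_{j1}²) R d^k ((λ²d)^k−1)/(λ²d−1)` and similarly for
`Y^{(i)'}_{ρ,k}`. -/
theorem broadcast_noisy_levelCount_moments
    (q d : ℕ) (hq : 3 ≤ q) (hd : 1 ≤ d) (p : ℝ) (hp0 : 0 < p) (hp1 : p < 1)
    (Ω : Type) [MeasurableSpace Ω] (μ : Measure Ω) [IsProbabilityMeasure μ]
    (σ τ : List (Fin d) → Ω → Fin q)
    (hmeas : ∀ v, Measurable (σ v)) (hmeasτ : ∀ v, Measurable (τ v))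
    (Δ : Fin q → Fin q → ℝ)
    (hΔ01 : ∀ i j, 0 ≤ Δ i j ∧ Δ i j ≤ 1)
    (hΔcol : ∀ j, ∑ i : Fin q, Δ i j = 1)
    (hΔdiag : ∀ i, 1 - 1 / (q : ℝ) ≤ Δ i i)
    (hlaw : ∀ (k : ℕ) (ℓ t : List (Fin d) → Fin q),
      (μ {ω | ∀ v : List (Fin d), v.length ≤ k → σ v ω = ℓ v ∧ τ v ω = t v}).toReal
        = ((q : ℝ))⁻¹ *
          (∏ j ∈ Finset.range k, ∏ f : Fin j → Fin d, ∏ i : Fin d,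
            transM q p (ℓ (List.ofFn f)) (ℓ (i :: List.ofFn f))) *
          ∏ j ∈ Finset.range (k + 1), ∏ f : Fin j → Fin d,
            Δ (ℓ (List.ofFn f)) (t (List.ofFn f)))
    (lam : ℝ) (hlam : lam = 1 - p * q / ((q : ℝ) - 1))
    (hKS : lam ^ 2 * d > 1)
    (R : ℝ) (hR : R = p * (2 - p - p / ((q : ℝ) - 1))) :
    (∀ (k : ℕ),
      ∫ ω, (levelCount q d τ (⟨0, by omega⟩ : Fin q) k ω : ℝ)
          ∂(μ[|{ω | σ [] ω = (⟨0, by omega⟩ : Fin q)}])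
        = (Δ ⟨0, by omega⟩ ⟨0, by omega⟩ - 1 / (q : ℝ)) * (lam * d) ^ k + (d : ℝ) ^ k / q) ∧
    (∀ (k : ℕ) (i : Fin q), i ≠ (⟨0, by omega⟩ : Fin q) →
      ∫ ω, (levelCount q d τ i k ω : ℝ)
          ∂(μ[|{ω | σ [] ω = (⟨0, by omega⟩ : Fin q)}])
        = (Δ ⟨0, by omega⟩ i - 1 / (q : ℝ)) * (lam * d) ^ k + (d : ℝ) ^ k / q) ∧
    (∃ C : ℝ, 0 < C ∧
      (∀ (k : ℕ),
        variance (fun ω => (levelCount q d τ (⟨0, by omega⟩ : Fin q) k ω : ℝ))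
            (μ[|{ω | σ [] ω = (⟨0, by omega⟩ : Fin q)}])
          ≤ C * (d : ℝ) ^ k + (∑ j : Fin q, (Δ j ⟨0, by omega⟩) ^ 2) *
              R * (d : ℝ) ^ k * ((lam ^ 2 * d) ^ k - 1) / (lam ^ 2 * d - 1)) ∧
      (∀ (k : ℕ) (i : Fin q), i ≠ (⟨0, by omega⟩ : Fin q) →
        variance (fun ω => (levelCount q d τ i k ω : ℝ))
            (μ[|{ω | σ [] ω = (⟨0, by omega⟩ : Fin q)}])
          ≤ C * (d : ℝ) ^ k + (∑ j : Fin q, (Δ j i) ^ 2) *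
              R * (d : ℝ) ^ k * ((lam ^ 2 * d) ^ k - 1) / (lam ^ 2 * d - 1))) := by
  have hq' : (3 : ℝ) ≤ q := by exact_mod_cast hq
  have hq1 : (q : ℝ) - 1 ≠ 0 := by linarith
  have hlam' : lam = 1 - p - p / ((q : ℝ) - 1) := by
    rw [hlam]
    field_simp
    ring
  have hlam0 : lam ≠ 0 := by
    rintro rfl
    norm_num at hKS
  have hΔ0 : ∀ i j, 0 ≤ Δ i j := fun i j => (hΔ01 i j).1
  have hΔpos : ∀ i, 0 < Δ i i := by
    intro i
    refine lt_of_lt_of_le ?_ (hΔdiag i)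
    rw [sub_pos, div_lt_one (by linarith)]
    linarith
  have hL : HasBroadcastLaw μ q d p Δ σ τ := hlaw
  have hrow := hL.sum_noise_eq_one hmeas hmeasτ hq hd hp0 hp1 (hlam' ▸ hlam0) hΔ0 hΔcol hΔpos
  have hmean := hL.integral_levelCount hmeas hmeasτ hrow hq hΔcol
  have hvar : ∀ (i : Fin q) (k : ℕ),
      variance (fun ω => (levelCount q d τ i k ω : ℝ))
          (μ[|{ω | σ [] ω = (⟨0, by omega⟩ : Fin q)}]) ≤
        1 * (d : ℝ) ^ k + (∑ j : Fin q, (Δ j i) ^ 2) *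
          R * (d : ℝ) ^ k * ((lam ^ 2 * d) ^ k - 1) / (lam ^ 2 * d - 1) := by
    intro i k
    have h := hL.variance_levelCount_le hmeas hmeasτ hrow hq hp0 hp1 hΔ0
      ⟨0, by omega⟩ i k
    rw [← hlam', ← hR, geom_sum_eq hKS.ne', ← mul_div_assoc] at h
    rwa [one_mul]
  rw [← hlam'] at hmean
  exact ⟨fun k => hmean _ _ k, fun k i _ => hmean _ i k, 1, one_pos, hvar _,
    fun k i _ => hvar i k⟩
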